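/- arXiv:2411.14763 — 6 statements merged into one kernel-verified Lean document; each statement's English description precedes it below -/
import Mathlib

section
/- If n ≥ 2 and the matrix X contains a column of ones (a constant) among its columns other than column k, then every partial leverage is strictly below one: h̃_{k,i} < 1 for all i = 1,…,n. -/
open Matrix BigOperators

/-- The Gram matrix of a real matrix with full column rank is invertible. -/
lemma isUnit_det_transpose_mul_self_of_rank_eq_card {m p : Type*} [Fintype m] [Fintype p]
    [DecidableEq p] (A : Matrix m p ℝ) (hA : A.rank = Fintype.card p) :
    IsUnit (Aᵀ * A).det := by
  rw [← Matrix.isUnit_iff_isUnit_det, ← Matrix.linearIndependent_cols_iff_isUnit,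
    linearIndependent_iff_card_eq_finrank_span, Set.finrank, ← Matrix.rank_eq_finrank_span_cols,
    Matrix.rank_transpose_mul_self, hA]

/-- The residual maker of a real matrix with full column rank annihilates its columns. -/
lemma transpose_mul_residualMaker {m p : Type*} [Fintype m] [Fintype p] [DecidableEq m]
    [DecidableEq p] (A : Matrix m p ℝ) (hA : A.rank = Fintype.card p) :
    Aᵀ * (1 - A * (Aᵀ * A)⁻¹ * Aᵀ) = 0 := by
  have hdet := isUnit_det_transpose_mul_self_of_rank_eq_card A hA
  rw [Matrix.mul_sub, Matrix.mul_one, ← Matrix.mul_assoc, ← Matrix.mul_assoc,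
    Matrix.mul_nonsing_inv _ hdet, Matrix.one_mul, sub_self]

/-- The normalized squares of a vector with zero sum are all strictly below one. -/
lemma sq_div_sum_sq_lt_one_of_sum_eq_zero {ι : Type*} [Fintype ι] (x : ι → ℝ)
    (hx : ∑ j, x j = 0) (i : ι) : x i ^ 2 / ∑ j, x j ^ 2 < 1 := by
  classical
  by_cases hi : x i = 0
  · simp [hi]
  have hpos : 0 < x i ^ 2 := by positivity
  obtain ⟨j, hj, hxj⟩ : ∃ j ∈ Finset.univ.erase i, x j ≠ 0 := by
    by_contra! hzero
    rw [← Finset.add_sum_erase _ _ (Finset.mem_univ i), Finset.sum_eq_zero hzero, add_zero] at hx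
    exact hi hx
  have hrest : 0 < ∑ l ∈ Finset.univ.erase i, x l ^ 2 :=
    Finset.sum_pos' (fun l _ => sq_nonneg _) ⟨j, hj, by positivity⟩
  rw [← Finset.add_sum_erase _ _ (Finset.mem_univ i), div_lt_one (by positivity)]
  linarith

/-- If `n ≥ 2` and `X` contains a constant column among the columns other
than `k`, then every partial leverage is strictly below one. -/
theorem partial_leverage_lt_one_of_constant
    (n K : ℕ) (hn : 2 ≤ n) (hK : 2 ≤ K)
    (X : Matrix (Fin n) (Fin K) ℝ) (k : Fin K)
    (hXrank : X.rank = K)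
    (Xmk : Matrix (Fin n) {j : Fin K // j ≠ k} ℝ)
    (hXmk : Xmk = Matrix.of fun i j => X i j.val)
    (hXmkRank : Xmk.rank = K - 1)
    (hconst : ∃ j : {j : Fin K // j ≠ k}, ∀ i, Xmk i j = 1)
    (Mmk : Matrix (Fin n) (Fin n) ℝ)
    (hMmk : Mmk = 1 - Xmk * (Xmkᵀ * Xmk)⁻¹ * Xmkᵀ)
    (xt : Fin n → ℝ)
    (hxt : xt = Mmk.mulVec (fun i => X i k))
    (h : Fin n → ℝ)
    (hh : h = fun i => (xt i) ^ 2 / ∑ j, (xt j) ^ 2) :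
    ∀ i, h i < 1 := by
  have hcard : Xmk.rank = Fintype.card {j : Fin K // j ≠ k} := by
    rw [hXmkRank]
    simp
  obtain ⟨j, hj⟩ := hconst
  have hsum : ∑ i, xt i = 0 := by
    have horth : Xmkᵀ *ᵥ xt = 0 := by
      rw [hxt, hMmk, Matrix.mulVec_mulVec, transpose_mul_residualMaker Xmk hcard,
        Matrix.zero_mulVec]
    simpa [Matrix.mulVec, dotProduct, hj] using congrFun horth j
  intro i
  rw [hh]
  exact sq_div_sum_sq_lt_one_of_sum_eq_zero xt hsum i
end

section
/- (Frisch–Waugh–Lovell) The k-th component of the full-regression OLS estimator equals the OLS slope from the residualized simple regression: β̂_k = (x̃_kᵀ ỹ_k) / (x̃_kᵀ x̃_k), where ỹ_k = M_{-k} y; moreover, the residual vector of the simple regression of ỹ_k on x̃_k equals the residual vector ε̂ = y − Xβ̂ of the full regression. -/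
open Matrix BigOperators

namespace Matrix

variable {m p : Type*} [Fintype p]

/-- A real matrix of full column rank has trivial kernel. -/
theorem mulVec_injective_of_rank_eq_card {A : Matrix m p ℝ} (hA : A.rank = Fintype.card p) :
    Function.Injective A.mulVec := by
  rw [mulVec_injective_iff, linearIndependent_iff_card_eq_finrank_span,
    ← hA, rank_eq_finrank_span_cols, Set.finrank]

/-- The Gram matrix of a real matrix of full column rank is invertible. -/
theorem isUnit_det_transpose_mul_self [Fintype m] [DecidableEq p] {A : Matrix m p ℝ}
    (hA : A.rank = Fintype.card p) : IsUnit (Aᵀ * A).det := by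
  rw [← isUnit_iff_isUnit_det, ← mulVec_injective_iff_isUnit]
  exact mulVec_injective_of_rank_eq_card (by rw [rank_transpose_mul_self, hA])

/-- The normal equations: least-squares residuals are orthogonal to the columns. -/
theorem transpose_mulVec_ols_residual [Fintype m] [DecidableEq p] {A : Matrix m p ℝ}
    (hA : IsUnit (Aᵀ * A).det) (y : m → ℝ) : Aᵀ *ᵥ (y - A *ᵥ (((Aᵀ * A)⁻¹ * Aᵀ) *ᵥ y)) = 0 := by
  rw [mulVec_sub, mulVec_mulVec, mulVec_mulVec, ← Matrix.mul_assoc,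
    mul_nonsing_inv _ hA, Matrix.one_mul, sub_self]

/-- The projection onto the orthogonal complement of the column space is symmetric. -/
theorem transpose_one_sub_projection [Fintype m] [DecidableEq m] [DecidableEq p] (A : Matrix m p ℝ) :
    (1 - A * (Aᵀ * A)⁻¹ * Aᵀ)ᵀ = 1 - A * (Aᵀ * A)⁻¹ * Aᵀ := by
  simp [transpose_nonsing_inv, Matrix.mul_assoc]

/-- The projection onto the orthogonal complement of the column space kills the columns. -/
theorem one_sub_projection_mul_self [Fintype m] [DecidableEq m] [DecidableEq p] {A : Matrix m p ℝ}
    (hA : IsUnit (Aᵀ * A).det) : (1 - A * (Aᵀ * A)⁻¹ * Aᵀ) * A = 0 := by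
  rw [Matrix.sub_mul, Matrix.one_mul, Matrix.mul_assoc, Matrix.mul_assoc,
    nonsing_inv_mul _ hA, Matrix.mul_one, sub_self]

/-- The projection onto the orthogonal complement of the column space fixes that complement. -/
theorem one_sub_projection_mulVec_of_transpose_mulVec_eq_zero [Fintype m] [DecidableEq m] [DecidableEq p]
    {A : Matrix m p ℝ} {v : m → ℝ}
    (hv : Aᵀ *ᵥ v = 0) : (1 - A * (Aᵀ * A)⁻¹ * Aᵀ) *ᵥ v = v := by
  rw [sub_mulVec, one_mulVec, ← mulVec_mulVec, hv, mulVec_zero, sub_zero]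

/-- Splitting one column off a matrix-vector product. -/
theorem mulVec_eq_smul_col_add [DecidableEq p] (A : Matrix m p ℝ) (k : p) (b : p → ℝ) :
    A *ᵥ b = b k • (fun i => A i k) +
      (of fun i (j : {j : p // j ≠ k}) => A i j.val) *ᵥ fun j => b j.val := by
  ext i
  simp only [mulVec, dotProduct, Pi.add_apply, Pi.smul_apply, smul_eq_mul, of_apply]
  rw [Fintype.sum_eq_add_sum_subtype_ne _ k, mul_comm]

end Matrix

/-- Frisch–Waugh–Lovell: `β̂_k = (x̃_kᵀ ỹ_k)/(x̃_kᵀ x̃_k)` with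
`ỹ_k = M_{-k} y`, and the residual vector of the simple regression of `ỹ_k` on `x̃_k`
equals the residual vector `ε̂ = y − Xβ̂` of the full regression. -/
theorem frisch_waugh_lovell
    (n K : ℕ)
    (X : Matrix (Fin n) (Fin K) ℝ) (k : Fin K)
    (hXrank : X.rank = K)
    (y : Fin n → ℝ)
    (βhat : Fin K → ℝ)
    (hβhat : βhat = ((Xᵀ * X)⁻¹ * Xᵀ).mulVec y)
    (εhat : Fin n → ℝ)
    (hεhat : εhat = y - X.mulVec βhat)
    (Xmk : Matrix (Fin n) {j : Fin K // j ≠ k} ℝ)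
    (hXmk : Xmk = Matrix.of fun i j => X i j.val)
    (hXmkRank : Xmk.rank = K - 1)
    (Mmk : Matrix (Fin n) (Fin n) ℝ)
    (hMmk : Mmk = 1 - Xmk * (Xmkᵀ * Xmk)⁻¹ * Xmkᵀ)
    (xt : Fin n → ℝ)
    (hxt : xt = Mmk.mulVec (fun i => X i k))
    (yt : Fin n → ℝ)
    (hyt : yt = Mmk.mulVec y) :
    βhat k = (∑ i, xt i * yt i) / (∑ i, xt i * xt i) ∧
    (fun i => yt i - ((∑ j, xt j * yt j) / (∑ j, xt j * xt j)) * xt i) = εhat := by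
  have hWcard : Xmk.rank = Fintype.card {j : Fin K // j ≠ k} := by
    simpa [Fintype.card_subtype_compl] using hXmkRank
  have hW := isUnit_det_transpose_mul_self hWcard
  have hXcard : X.rank = Fintype.card (Fin K) := by simpa using hXrank
  have hXε : Xᵀ *ᵥ εhat = 0 := by
    rw [hεhat, hβhat]
    exact transpose_mulVec_ols_residual (isUnit_det_transpose_mul_self hXcard) y
  have hWε : Xmkᵀ *ᵥ εhat = 0 := by
    ext j
    simpa [hXmk, mulVec, dotProduct] using congrFun hXε j.val
  have hMε : Mmk *ᵥ εhat = εhat := by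
    rw [hMmk]
    exact one_sub_projection_mulVec_of_transpose_mulVec_eq_zero hWε
  have hMW : Mmk * Xmk = 0 := by
    rw [hMmk]
    exact one_sub_projection_mul_self hW
  have hMX (b : Fin K → ℝ) : Mmk *ᵥ (X *ᵥ b) = b k • xt := by
    rw [mulVec_eq_smul_col_add X k b, ← hXmk, mulVec_add, mulVec_smul, mulVec_mulVec, hMW,
      zero_mulVec, add_zero, hxt]
  have hyt_eq : yt = βhat k • xt + εhat := by
    rw [hyt, ← hMX, ← hMε, ← mulVec_add, hεhat, add_sub_cancel]
  have hxtε : xt ⬝ᵥ εhat = 0 := by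
    have hMT : Mmkᵀ = Mmk := by
      rw [hMmk]
      exact transpose_one_sub_projection Xmk
    rw [hxt, dotProduct_comm, dotProduct_mulVec, ← mulVec_transpose, hMT, hMε, dotProduct_comm]
    exact congrFun hXε k
  have hxt_ne : xt ≠ 0 := by
    intro h0
    have hcol : (fun i => X i k) = Xmk *ᵥ (((Xmkᵀ * Xmk)⁻¹ * Xmkᵀ) *ᵥ fun i => X i k) := by
      rw [hxt, hMmk, sub_mulVec, one_mulVec, sub_eq_zero] at h0
      rwa [mulVec_mulVec, ← Matrix.mul_assoc]
    set c := ((Xmkᵀ * Xmk)⁻¹ * Xmkᵀ) *ᵥ fun i => X i k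
    let b : Fin K → ℝ := fun j => if h : j = k then 1 else -c ⟨j, h⟩
    have hbk : b k = 1 := by simp [b]
    have hbc : (fun j : {j : Fin K // j ≠ k} => b j.val) = -c := by
      ext j
      simp [b, j.property]
    have hXb : X *ᵥ b = X *ᵥ 0 := by
      rw [mulVec_eq_smul_col_add X k b, ← hXmk, hbk, hbc, one_smul, mulVec_neg, ← hcol,
        add_neg_cancel, mulVec_zero]
    have hb := congrFun (mulVec_injective_of_rank_eq_card hXcard hXb) k
    simp [hbk] at hb
  have hslope : βhat k = (xt ⬝ᵥ yt) / (xt ⬝ᵥ xt) := by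
    rw [hyt_eq, dotProduct_add, dotProduct_smul, hxtε, add_zero, smul_eq_mul,
      mul_div_cancel_right₀ _ (dotProduct_self_eq_zero.not.mpr hxt_ne)]
  refine ⟨hslope, ?_⟩
  change (fun i => yt i - (xt ⬝ᵥ yt) / (xt ⬝ᵥ xt) * xt i) = εhat
  rw [← hslope]
  ext i
  simp [hyt_eq]
end

section
/- If an observation has leverage one, its OLS residual is exactly zero: h_i = 1 implies ε̂_i = 0, for any y ∈ ℝⁿ. -/
open Matrix BigOperators

/-- A row of a real symmetric idempotent matrix whose diagonal entry is one is a unit vector. -/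
theorem Matrix.IsSymm.row_eq_single_of_isIdempotentElem {ι : Type*} [Fintype ι] [DecidableEq ι]
    {P : Matrix ι ι ℝ} (hsymm : P.IsSymm) (hidem : IsIdempotentElem P) {i : ι}
    (hi : P i i = 1) : P i = Pi.single i 1 := by
  have hsum : ∑ j, P i j ^ 2 = 1 := by
    rw [← hi]
    conv_rhs => rw [← hidem.eq, Matrix.mul_apply]
    exact Finset.sum_congr rfl fun j _ => by rw [hsymm.apply i j, sq]
  rw [← Finset.add_sum_erase _ _ (Finset.mem_univ i), hi, one_pow, add_eq_left,
    Finset.sum_eq_zero_iff_of_nonneg fun j _ => sq_nonneg _] at hsum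
  ext j
  by_cases hj : j = i
  · subst hj
    simpa using hi
  · simpa [hj] using hsum j (by simp [hj])

/-- The hat matrix `X (XᵀX)⁻¹ Xᵀ` is symmetric. -/
theorem Matrix.isSymm_hat {m k : Type*} [Fintype k] [Fintype m] [DecidableEq k]
    (X : Matrix m k ℝ) : (X * (Xᵀ * X)⁻¹ * Xᵀ).IsSymm := by
  simp [Matrix.IsSymm, Matrix.transpose_mul, Matrix.transpose_nonsing_inv, Matrix.mul_assoc]

/-- The hat matrix is idempotent, also when `XᵀX` is singular, since then `(XᵀX)⁻¹ = 0`. -/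
theorem Matrix.isIdempotentElem_hat {m k : Type*} [Fintype k] [Fintype m] [DecidableEq k]
    (X : Matrix m k ℝ) : IsIdempotentElem (X * (Xᵀ * X)⁻¹ * Xᵀ) := by
  by_cases hdet : IsUnit (Xᵀ * X).det
  · calc X * (Xᵀ * X)⁻¹ * Xᵀ * (X * (Xᵀ * X)⁻¹ * Xᵀ)
        = X * ((Xᵀ * X)⁻¹ * (Xᵀ * X)) * (Xᵀ * X)⁻¹ * Xᵀ := by simp only [Matrix.mul_assoc]
      _ = X * (Xᵀ * X)⁻¹ * Xᵀ := by rw [Matrix.nonsing_inv_mul _ hdet, Matrix.mul_one]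
  · simp [IsIdempotentElem, Matrix.nonsing_inv_apply_not_isUnit _ hdet]

/-- If an observation has leverage one, its OLS residual is exactly zero. -/
theorem residual_eq_zero_of_leverage_one
    (n K : ℕ)
    (X : Matrix (Fin n) (Fin K) ℝ)
    (hXrank : X.rank = K)
    (y : Fin n → ℝ)
    (βhat : Fin K → ℝ)
    (hβhat : βhat = ((Xᵀ * X)⁻¹ * Xᵀ).mulVec y)
    (εhat : Fin n → ℝ)
    (hεhat : εhat = y - X.mulVec βhat)
    (H : Matrix (Fin n) (Fin n) ℝ)
    (hH : H = X * (Xᵀ * X)⁻¹ * Xᵀ)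
    (h : Fin n → ℝ)
    (hh : h = fun i => H i i)
    (i : Fin n)
    (hi : h i = 1) :
    εhat i = 0 := by
  subst hh hεhat hβhat
  have hrow : H i = Pi.single i 1 := by
    subst hH
    exact X.isSymm_hat.row_eq_single_of_isIdempotentElem X.isIdempotentElem_hat hi
  rw [Matrix.mulVec_mulVec, ← Matrix.mul_assoc, ← hH, Pi.sub_apply, Matrix.mulVec, hrow,
    single_one_dotProduct, sub_self]
end

section
/- The HC3 variance estimator equals the jackknife sum of squared leave-one-out coefficient deviations: V̂^{HC3}(β̂) = Σ_{i=1}^n (β̂_{(i)} − β̂)(β̂_{(i)} − β̂)ᵀ. -/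
open Matrix BigOperators

namespace Matrix

variable {m k : Type*} [Fintype m]

/-- The Gram matrix of a real matrix with full column rank is invertible. -/
theorem isUnit_det_transpose_mul_self_of_rank_eq [Fintype k] [DecidableEq k]
    (X : Matrix m k ℝ) (hX : X.rank = Fintype.card k) : IsUnit (Xᵀ * X).det := by
  rw [← isUnit_iff_isUnit_det, ← mulVec_injective_iff_isUnit]
  have hrank : (Xᵀ * X).rank = Fintype.card k := by rw [rank_transpose_mul_self, hX]
  have hsurj : Function.Surjective (Xᵀ * X).mulVecLin := by
    rw [← LinearMap.range_eq_top]
    apply Submodule.eq_top_of_finrank_eq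
    rw [Module.finrank_fintype_fun_eq_card]
    exact hrank
  exact LinearMap.injective_iff_surjective.mpr hsurj

theorem transpose_mul_self_submatrix_ne [DecidableEq m] (X : Matrix m k ℝ) (i : m) :
    (of fun (j : {j // j ≠ i}) l => X j l)ᵀ * (of fun (j : {j // j ≠ i}) l => X j l) =
      Xᵀ * X - vecMulVec (X i) (X i) := by
  ext a b
  simp only [mul_apply, transpose_apply, of_apply, sub_apply, vecMulVec_apply]
  rw [Fintype.sum_eq_add_sum_subtype_ne (fun j => X j a * X j b) i]
  ring

theorem transpose_mulVec_submatrix_ne [DecidableEq m] (X : Matrix m k ℝ) (y : m → ℝ) (i : m) :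
    (of fun (j : {j // j ≠ i}) l => X j l)ᵀ *ᵥ (fun j => y j) = Xᵀ *ᵥ y - y i • X i := by
  ext a
  simp only [mulVec, dotProduct, transpose_apply, of_apply, Pi.sub_apply, Pi.smul_apply,
    smul_eq_mul]
  rw [Fintype.sum_eq_add_sum_subtype_ne (fun j => X j a * y j) i]
  ring

/-- Solution of the normal equations after a rank-one downdate of the Gram matrix `A`. -/
theorem inv_sub_vecMulVec_mulVec [Fintype k] [DecidableEq k]
    (A : Matrix k k ℝ) (x z : k → ℝ) (t : ℝ) (hA : IsUnit A.det)
    (hB : IsUnit (A - vecMulVec x x).det) (hx : x ⬝ᵥ A⁻¹ *ᵥ x ≠ 1) :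
    (A - vecMulVec x x)⁻¹ *ᵥ (z - t • x) =
      A⁻¹ *ᵥ z - ((1 - x ⬝ᵥ A⁻¹ *ᵥ x)⁻¹ * (t - x ⬝ᵥ A⁻¹ *ᵥ z)) • A⁻¹ *ᵥ x := by
  have h1 : 1 - x ⬝ᵥ A⁻¹ *ᵥ x ≠ 0 := sub_ne_zero.mpr hx.symm
  have key : (A - vecMulVec x x) *ᵥ
      (A⁻¹ *ᵥ z - ((1 - x ⬝ᵥ A⁻¹ *ᵥ x)⁻¹ * (t - x ⬝ᵥ A⁻¹ *ᵥ z)) • A⁻¹ *ᵥ x) = z - t • x := by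
    have hz (v : k → ℝ) : A *ᵥ A⁻¹ *ᵥ v = v := by
      rw [mulVec_mulVec, mul_nonsing_inv _ hA, one_mulVec]
    simp only [sub_mulVec, mulVec_sub, mulVec_smul, hz, vecMulVec_mulVec]
    ext a
    simp only [Pi.sub_apply, Pi.smul_apply, smul_eq_mul, MulOpposite.smul_eq_mul_unop,
      MulOpposite.unop_op]
    field_simp
    ring
  rw [← key, mulVec_mulVec, nonsing_inv_mul _ hB, one_mulVec]

end Matrix

/-- The HC3 variance estimator equals the jackknife sum of squared
leave-one-out coefficient deviations:
`V̂^{HC3}(β̂) = ∑ i (β̂_{(i)} − β̂)(β̂_{(i)} − β̂)ᵀ`. -/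
theorem hc3_eq_jackknife
    (n K : ℕ) (hnK : K + 1 ≤ n)
    (X : Matrix (Fin n) (Fin K) ℝ)
    (hXrank : X.rank = K)
    (y : Fin n → ℝ)
    (βhat : Fin K → ℝ)
    (hβhat : βhat = ((Xᵀ * X)⁻¹ * Xᵀ).mulVec y)
    (εhat : Fin n → ℝ)
    (hεhat : εhat = y - X.mulVec βhat)
    (H : Matrix (Fin n) (Fin n) ℝ)
    (hH : H = X * (Xᵀ * X)⁻¹ * Xᵀ)
    (h : Fin n → ℝ)
    (hh : h = fun i => H i i)
    (hlev : ∀ i, h i < 1)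
    (Xi : ∀ i : Fin n, Matrix {j : Fin n // j ≠ i} (Fin K) ℝ)
    (hXi : ∀ i, Xi i = Matrix.of fun j l => X j.val l)
    (hXiRank : ∀ i, (Xi i).rank = K)
    (yi : ∀ i : Fin n, {j : Fin n // j ≠ i} → ℝ)
    (hyi : ∀ i, yi i = fun j => y j.val)
    (βhati : Fin n → Fin K → ℝ)
    (hβhati : ∀ i, βhati i = (((Xi i)ᵀ * Xi i)⁻¹ * (Xi i)ᵀ).mulVec (yi i))
    (VHC3 : Matrix (Fin K) (Fin K) ℝ)
    (hVHC3 : VHC3 =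
      (Xᵀ * X)⁻¹ *
        (Matrix.of fun c d => ∑ i, ((1 - h i)⁻¹) ^ 2 * (εhat i) ^ 2 * X i c * X i d) *
        (Xᵀ * X)⁻¹) :
    VHC3 = Matrix.of fun a b => ∑ i, (βhati i a - βhat a) * (βhati i b - βhat b) := by
  have hA : IsUnit (Xᵀ * X).det :=
    isUnit_det_transpose_mul_self_of_rank_eq X (by simpa using hXrank)
  have hsymm : (Xᵀ * X)⁻¹ᵀ = (Xᵀ * X)⁻¹ := by
    rw [transpose_nonsing_inv, transpose_mul, transpose_transpose]
  have hlevDot (i : Fin n) : h i = X i ⬝ᵥ (Xᵀ * X)⁻¹ *ᵥ X i := by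
    rw [hh, hH, Matrix.mul_assoc]
    rfl
  have hdev (i : Fin n) :
      βhati i - βhat = -((1 - h i)⁻¹ * εhat i) • (Xᵀ * X)⁻¹ *ᵥ X i := by
    have hB := isUnit_det_transpose_mul_self_of_rank_eq (Xi i) (by simpa using hXiRank i)
    rw [hXi, transpose_mul_self_submatrix_ne] at hB
    have hne : X i ⬝ᵥ (Xᵀ * X)⁻¹ *ᵥ X i ≠ 1 := by
      rw [← hlevDot]
      exact (hlev i).ne
    have hε : εhat i = y i - X i ⬝ᵥ (Xᵀ * X)⁻¹ *ᵥ Xᵀ *ᵥ y := by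
      rw [hεhat, hβhat, ← mulVec_mulVec]
      rfl
    rw [hβhati, hyi, hXi, ← mulVec_mulVec, transpose_mul_self_submatrix_ne,
      transpose_mulVec_submatrix_ne, inv_sub_vecMulVec_mulVec _ _ _ _ hA hB hne, hβhat,
      hlevDot, hε, mulVec_mulVec y, neg_smul]
    abel
  have hmid : (of fun c d => ∑ i, ((1 - h i)⁻¹) ^ 2 * (εhat i) ^ 2 * X i c * X i d) =
      ∑ i, (((1 - h i)⁻¹) ^ 2 * (εhat i) ^ 2) • vecMulVec (X i) (X i) := by
    ext c d
    simp [Matrix.sum_apply, vecMulVec_apply, mul_assoc]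
  have hright (i : Fin n) : X i ᵥ* (Xᵀ * X)⁻¹ = (Xᵀ * X)⁻¹ *ᵥ X i := by
    rw [← mulVec_transpose, hsymm]
  ext a b
  simp only [hVHC3, hmid, Matrix.mul_sum, Matrix.sum_mul, Matrix.mul_smul, Matrix.smul_mul,
    mul_vecMulVec, vecMulVec_mul, hright, Matrix.sum_apply, of_apply, Matrix.smul_apply,
    vecMulVec_apply, smul_eq_mul]
  refine Finset.sum_congr rfl fun i _ => ?_
  rw [← Pi.sub_apply, ← Pi.sub_apply, hdev]
  simp only [Pi.smul_apply, smul_eq_mul]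
  ring
end

section
/- (Ding 2021) The k-th diagonal element of the HC0 variance estimator can be computed from the Frisch–Waugh–Lovell representation: [V̂^{HC0}(β̂)]_{kk} = (Σ_{i=1}^n ε̂_i² x̃_{k,i}²) / (Σ_{i=1}^n x̃_{k,i}²)². -/
open Matrix BigOperators

namespace Matrix

variable {m n : Type*} [Fintype m] [Fintype n]

/-- The diagonal of a sandwich `A (∑ i, w i • x i (x i)ᵀ) A` with symmetric `A`. -/
theorem sandwich_apply_diag {X : Matrix m n ℝ} {A : Matrix n n ℝ} (hA : A.IsSymm) (w : m → ℝ)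
    (k : n) :
    (A * (of fun c d => ∑ i, w i * X i c * X i d) * A) k k =
      ∑ i, w i * (X *ᵥ A.col k) i ^ 2 := by
  have hB : (of fun c d => ∑ i, w i * X i c * X i d) = Xᵀ * (of fun i d => w i * X i d) := by
    ext c d
    simp only [of_apply, mul_apply, transpose_apply]
    exact Finset.sum_congr rfl fun i _ => by ring
  have hl : ∀ i, (A * Xᵀ) k i = (X *ᵥ A.col k) i := fun i => by
    simp only [mul_apply, mulVec, dotProduct, transpose_apply, col_apply]
    exact Finset.sum_congr rfl fun j _ => by rw [hA.apply, mul_comm]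
  have hr : ∀ i, ((of fun i d => w i * X i d) * A) i k = w i * (X *ᵥ A.col k) i := fun i => by
    simp only [mul_apply, mulVec, dotProduct, of_apply, col_apply, Finset.mul_sum, mul_assoc]
  rw [hB, ← Matrix.mul_assoc, Matrix.mul_assoc (A * Xᵀ), mul_apply]
  exact Finset.sum_congr rfl fun i _ => by rw [hl, hr]; ring

variable [DecidableEq n]

theorem isUnit_det_transpose_mul_self_of_rank_eq_card {X : Matrix m n ℝ}
    (h : X.rank = Fintype.card n) : IsUnit (Xᵀ * X).det := by
  rw [← isUnit_iff_isUnit_det, ← mulVec_surjective_iff_isUnit, ← coe_mulVecLin,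
    ← LinearMap.range_eq_top]
  apply Submodule.eq_top_of_finrank_eq
  rw [Module.finrank_fintype_fun_eq_card, ← h, ← rank_transpose_mul_self X]
  rfl

/-- Residuals of a regression on `X` are orthogonal to the columns of `X`. -/
theorem transpose_mulVec_residual [DecidableEq m] {X : Matrix m n ℝ}
    (h : IsUnit (Xᵀ * X).det) (v : m → ℝ) :
    Xᵀ *ᵥ ((1 - X * (Xᵀ * X)⁻¹ * Xᵀ) *ᵥ v) = 0 := by
  rw [mulVec_mulVec, Matrix.mul_sub, ← Matrix.mul_assoc, ← Matrix.mul_assoc,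
    mul_nonsing_inv _ h, Matrix.one_mul, Matrix.mul_one, sub_self, zero_mulVec]

/-- If `X *ᵥ c` has `c k = 1` and is orthogonal to every column of `X` other than the `k`-th,
then it is, up to its squared length, the image under `X` of the `k`-th column of the inverse
Gram matrix. -/
theorem mulVec_inv_gram_col_eq {X : Matrix m n ℝ} (hX : IsUnit (Xᵀ * X).det) {k : n} {c : n → ℝ}
    (hck : c k = 1) (horth : ∀ j, j ≠ k → (Xᵀ *ᵥ (X *ᵥ c)) j = 0) :
    X *ᵥ (Xᵀ * X)⁻¹.col k = (∑ i, (X *ᵥ c) i ^ 2)⁻¹ • (X *ᵥ c) := by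
  set s := ∑ i, (X *ᵥ c) i ^ 2 with hs
  have hgram : Xᵀ *ᵥ (X *ᵥ c) = Pi.single k ((Xᵀ *ᵥ (X *ᵥ c)) k) := by
    ext j
    by_cases hj : j = k
    · subst hj; simp
    · simp only [Pi.single_eq_of_ne hj, horth j hj]
  have hsk : s = (Xᵀ *ᵥ (X *ᵥ c)) k := by
    have hdot : s = c ⬝ᵥ (Xᵀ *ᵥ (X *ᵥ c)) := by
      rw [dotProduct_mulVec, vecMul_transpose]
      simp only [hs, dotProduct, sq]
    rw [hdot, hgram]
    simp [hck]
  rw [← hsk, mulVec_mulVec] at hgram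
  have hc : c = s • (Xᵀ * X)⁻¹.col k := by
    calc c = (Xᵀ * X)⁻¹ *ᵥ ((Xᵀ * X) *ᵥ c) := by
          rw [mulVec_mulVec, nonsing_inv_mul _ hX, one_mulVec]
      _ = s • (Xᵀ * X)⁻¹.col k := by
          rw [hgram, mulVec_single, op_smul_eq_smul]
  have hs0 : s ≠ 0 := by
    intro h
    rw [h, zero_smul] at hc
    simp [hc] at hck
  conv_rhs => rw [hc]
  rw [mulVec_smul, smul_smul, inv_mul_cancel₀ hs0, one_smul]

end Matrix

/-- Ding 2021: The k-th diagonal element of the HC0 variance estimator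
can be computed from the FWL representation:
`[V̂^{HC0}(β̂)]_{kk} = (∑ i ε̂_i² x̃_{k,i}²) / (∑ i x̃_{k,i}²)²`. -/
theorem hc0_diagonal_fwl
    (n K : ℕ)
    (X : Matrix (Fin n) (Fin K) ℝ) (k : Fin K)
    (hXrank : X.rank = K)
    (y : Fin n → ℝ)
    (βhat : Fin K → ℝ)
    (hβhat : βhat = ((Xᵀ * X)⁻¹ * Xᵀ).mulVec y)
    (εhat : Fin n → ℝ)
    (hεhat : εhat = y - X.mulVec βhat)
    (VHC0 : Matrix (Fin K) (Fin K) ℝ)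
    (hVHC0 : VHC0 =
      (Xᵀ * X)⁻¹ *
        (Matrix.of fun c d => ∑ i, (εhat i) ^ 2 * X i c * X i d) *
        (Xᵀ * X)⁻¹)
    (Xmk : Matrix (Fin n) {j : Fin K // j ≠ k} ℝ)
    (hXmk : Xmk = Matrix.of fun i j => X i j.val)
    (hXmkRank : Xmk.rank = K - 1)
    (Mmk : Matrix (Fin n) (Fin n) ℝ)
    (hMmk : Mmk = 1 - Xmk * (Xmkᵀ * Xmk)⁻¹ * Xmkᵀ)
    (xt : Fin n → ℝ)
    (hxt : xt = Mmk.mulVec (fun i => X i k)) :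
    VHC0 k k = (∑ i, (εhat i) ^ 2 * (xt i) ^ 2) / (∑ i, (xt i) ^ 2) ^ 2 := by
  have hX : IsUnit (Xᵀ * X).det :=
    isUnit_det_transpose_mul_self_of_rank_eq_card (by simpa using hXrank)
  have hXmkUnit : IsUnit (Xmkᵀ * Xmk).det :=
    isUnit_det_transpose_mul_self_of_rank_eq_card (by simp [hXmkRank])
  let γ := ((Xmkᵀ * Xmk)⁻¹ * Xmkᵀ) *ᵥ fun i => X i k
  let c : Fin K → ℝ := fun j => if h : j = k then 1 else -γ ⟨j, h⟩
  have hck : c k = 1 := dif_pos rfl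
  have hxtc : X *ᵥ c = xt := by
    rw [hxt, hMmk, sub_mulVec, one_mulVec, Matrix.mul_assoc, ← mulVec_mulVec]
    ext i
    have hsum : (X *ᵥ c) i = X i k * c k + ∑ j : {j : Fin K // j ≠ k}, X i j * c j :=
      Fintype.sum_eq_add_sum_subtype_ne (fun j => X i j * c j) k
    have hcj : ∀ j : {j : Fin K // j ≠ k}, c j = -γ j := fun j => dif_neg j.2
    simp only [hsum, hck, hcj, mul_one, mul_neg, Finset.sum_neg_distrib, ← sub_eq_add_neg,
      Pi.sub_apply]
    congr 1
    simp only [mulVec, dotProduct, hXmk, of_apply, γ]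
  have horth : ∀ j, j ≠ k → (Xᵀ *ᵥ (X *ᵥ c)) j = 0 := fun j hj => by
    have h := congrFun (transpose_mulVec_residual hXmkUnit fun i => X i k) ⟨j, hj⟩
    rw [← hMmk, ← hxt] at h
    rw [hXmk] at h
    rwa [hxtc]
  have hsymm : (Xᵀ * X)⁻¹.IsSymm := by
    rw [IsSymm, transpose_nonsing_inv, transpose_mul, transpose_transpose]
  rw [hVHC0, sandwich_apply_diag hsymm (fun i => εhat i ^ 2),
    mulVec_inv_gram_col_eq hX hck horth, hxtc, Finset.sum_div]
  refine Finset.sum_congr rfl fun i _ => ?_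
  rw [Pi.smul_apply, smul_eq_mul, mul_pow, inv_pow, div_eq_mul_inv]
  ring
end

section
/- Let the bootstrap p-value be p = K/B, where K is the beta-binomial mixture of Binomial(B, P) with P uniform on [0,1]. If B is chosen such that 0.05·(B+1) is an integer, then ℙ(p ≤ 0.05) = 0.05. -/
open MeasureTheory ProbabilityTheory BigOperators

theorem integral_pow_succ_mul_one_sub_pow (a b : ℕ) :
    ((b : ℝ) + 1) * ∫ x in (0 : ℝ)..1, x ^ (a + 1) * (1 - x) ^ b =
      ((a : ℝ) + 1) * ∫ x in (0 : ℝ)..1, x ^ a * (1 - x) ^ (b + 1) := by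
  have hderiv (x : ℝ) : HasDerivAt (fun x : ℝ => x ^ (a + 1) * (1 - x) ^ (b + 1))
      (((a : ℝ) + 1) * (x ^ a * (1 - x) ^ (b + 1)) -
        ((b : ℝ) + 1) * (x ^ (a + 1) * (1 - x) ^ b)) x := by
    refine (((hasDerivAt_id' x).fun_pow (a + 1)).fun_mul
      (((hasDerivAt_id' x).const_sub 1).fun_pow (b + 1))).congr_deriv ?_
    push_cast
    ring
  have hftc := intervalIntegral.integral_eq_sub_of_hasDerivAt
    (a := (0 : ℝ)) (b := 1) (fun x _ => hderiv x)
    (Continuous.intervalIntegrable (by fun_prop) _ _)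
  rw [intervalIntegral.integral_sub (Continuous.intervalIntegrable (by fun_prop) _ _)
    (Continuous.intervalIntegrable (by fun_prop) _ _),
    intervalIntegral.integral_const_mul, intervalIntegral.integral_const_mul] at hftc
  simp only [sub_self, ne_eq, Nat.add_eq_zero_iff, one_ne_zero, and_false, not_false_eq_true,
    zero_pow, mul_zero, zero_mul] at hftc
  linarith

theorem choose_mul_integral_pow_mul_one_sub_pow (a b : ℕ) :
    ((a + b).choose a : ℝ) * ∫ x in (0 : ℝ)..1, x ^ a * (1 - x) ^ b = 1 / ((a : ℝ) + b + 1) := by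
  induction a generalizing b with
  | zero =>
    have h := intervalIntegral.integral_comp_sub_left (a := 0) (b := 1) (fun x : ℝ => x ^ b) 1
    simp [h, integral_pow]
  | succ a ih =>
    have hchoose : ((a + 1 + b).choose (a + 1) : ℝ) * (a + 1) =
        ((a + (b + 1)).choose a : ℝ) * (b + 1) := by
      have h := Nat.choose_succ_right_eq (a + 1 + b) a
      rw [show a + 1 + b - a = b + 1 by omega] at h
      rw [show a + (b + 1) = a + 1 + b by omega]
      exact_mod_cast h
    have hb : (b : ℝ) + 1 ≠ 0 := by positivity
    have ha : (a : ℝ) + 1 ≠ 0 := by positivity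
    have hrec := integral_pow_succ_mul_one_sub_pow a b
    have hih := ih (b + 1)
    push_cast at hih ⊢
    rw [show (a : ℝ) + 1 + b + 1 = a + (b + 1) + 1 by ring, ← hih]
    apply mul_left_cancel₀ (mul_ne_zero ha hb)
    linear_combination ((b : ℝ) + 1) * (∫ x in (0 : ℝ)..1, x ^ (a + 1) * (1 - x) ^ b) * hchoose +
      ((a + (b + 1)).choose a : ℝ) * (b + 1) * hrec

/-- A beta-binomial variable with uniform mixing is uniform on `{0, …, n}`. -/
theorem integral_binomial_weight {n k : ℕ} (hk : k ≤ n) :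
    ∫ p in (0 : ℝ)..1, (n.choose k : ℝ) * p ^ k * (1 - p) ^ (n - k) = 1 / ((n : ℝ) + 1) := by
  obtain ⟨b, rfl⟩ := Nat.exists_eq_add_of_le hk
  simp_rw [mul_assoc, intervalIntegral.integral_const_mul, Nat.add_sub_cancel_left]
  rw [choose_mul_integral_pow_mul_one_sub_pow]
  push_cast
  rfl

/-- If the bootstrap p-value is `p = K/B` with `K` the beta-binomial
mixture of `Binomial(B, P)`, `P` uniform on `[0,1]`, and `0.05·(B+1)` is an integer,
then `ℙ(p ≤ 0.05) = 0.05`. -/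
theorem bootstrap_pvalue_rejection_probability
    (B : ℕ) (hB : 1 ≤ B)
    (hBint : ∃ m : ℕ, (0.05 : ℝ) * (B + 1) = m)
    (Ω : Type*) [MeasureSpace Ω] [IsProbabilityMeasure (ℙ : Measure Ω)]
    (K : Ω → ℕ) (hK : Measurable K)
    (hlaw : ∀ k : ℕ, (ℙ {ω | K ω = k}).toReal =
      ∫ p in (0:ℝ)..1, (B.choose k : ℝ) * p ^ k * (1 - p) ^ (B - k))
    (pval : Ω → ℝ)
    (hpval : ∀ ω, pval ω = (K ω : ℝ) / B) :
    (ℙ {ω | pval ω ≤ 0.05}).toReal = 0.05 := by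
  obtain ⟨m, hm⟩ := hBint
  have hBm : B + 1 = 20 * m := by
    have h : (B : ℝ) + 1 = 20 * m := by linarith
    exact_mod_cast h
  have hset : {ω | pval ω ≤ 0.05} = K ⁻¹' (Finset.range m : Set ℕ) := by
    ext ω
    have hBpos : (0 : ℝ) < B := by exact_mod_cast hB
    simp only [Set.mem_ofPred_eq, hpval, Set.mem_preimage, Finset.coe_range, Set.mem_Iio]
    rw [div_le_iff₀ hBpos]
    have hiff : (K ω : ℝ) ≤ 0.05 * B ↔ 20 * K ω ≤ B := by
      rw [← Nat.cast_le (α := ℝ)]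
      push_cast
      constructor <;> intro h <;> linarith
    rw [hiff]
    omega
  have hsum : (ℙ : Measure Ω).real (K ⁻¹' (Finset.range m : Set ℕ)) =
      ∑ k ∈ Finset.range m, (ℙ : Measure Ω).real (K ⁻¹' {k}) :=
    (sum_measureReal_preimage_singleton _ fun k _ => hK (measurableSet_singleton k)).symm
  have hmass : ∀ k ∈ Finset.range m,
      (ℙ : Measure Ω).real (K ⁻¹' {k}) = 1 / ((B : ℝ) + 1) := by
    intro k hk
    have hkB : k ≤ B := by
      have := Finset.mem_range.mp hk
      omega
    exact (hlaw k).trans (integral_binomial_weight hkB)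
  rw [hset, ← measureReal_def, hsum, Finset.sum_congr rfl hmass, Finset.sum_const,
    Finset.card_range, nsmul_eq_mul, ← hm]
  field_simp
end
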